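/- Let B ⊂ ℝᵈ be a convex set with 0 ∈ B and let g : B → ℝ be a concave function with g(u) ≥ 0 for all u ∈ B. Let G := {(u, g(u)) : u ∈ B} ⊂ ℝᵈ × ℝ be the graph of g. Then the intersection of the convex hull of {(0,0)} ∪ G with the vertical line {0} × ℝ equals {0} × [0, g(0)]. -/

import Mathlib

open MeasureTheory

/-- Fiber of a pyramid over the apex direction (key step of Lemma A.7): for a convex set
`B ∋ 0` and a nonnegative concave function `g` on `B` with graph `G`, the intersection of
`conv({(0,0)} ∪ G)` with the vertical line `{0} × ℝ` is `{0} × [0, g(0)]`. -/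
theorem pyramid_fiber_over_origin
    (d : ℕ) (B : Set (EuclideanSpace ℝ (Fin d)))
    (hconv : Convex ℝ B) (h0 : (0 : EuclideanSpace ℝ (Fin d)) ∈ B)
    (g : EuclideanSpace ℝ (Fin d) → ℝ)
    (hg : ConcaveOn ℝ B g) (hg0 : ∀ u ∈ B, 0 ≤ g u) :
    convexHull ℝ (insert ((0 : EuclideanSpace ℝ (Fin d)), (0 : ℝ))
        {p : EuclideanSpace ℝ (Fin d) × ℝ | p.1 ∈ B ∧ p.2 = g p.1}) ∩
      {p : EuclideanSpace ℝ (Fin d) × ℝ | p.1 = 0} =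
      {p : EuclideanSpace ℝ (Fin d) × ℝ | p.1 = 0 ∧ p.2 ∈ Set.Icc 0 (g 0)} := by
  ext ⟨x, t⟩
  simp only [Set.mem_inter_iff, Set.mem_ofPred_eq, Set.mem_Icc]
  constructor
  · rintro ⟨hmem, rfl⟩
    have hsub : convexHull ℝ (insert ((0 : EuclideanSpace ℝ (Fin d)), (0 : ℝ))
        {p : EuclideanSpace ℝ (Fin d) × ℝ | p.1 ∈ B ∧ p.2 = g p.1}) ⊆
        {p | p.1 ∈ B ∧ p.2 ≤ g p.1} ∩ Prod.snd ⁻¹' Set.Ici 0 := by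
      refine convexHull_min ?_ (hg.convex_hypograph.inter
        ((convex_Ici (0 : ℝ)).linear_preimage (LinearMap.snd ℝ _ ℝ)))
      rintro ⟨u, s⟩ (hp | ⟨hu, hs⟩)
      · obtain ⟨rfl, rfl⟩ := Prod.mk.inj hp
        exact ⟨⟨h0, hg0 _ h0⟩, le_refl (0 : ℝ)⟩
      · exact ⟨⟨hu, hs.le⟩, (hg0 u hu).trans_eq hs.symm⟩
    obtain ⟨⟨-, hle⟩, hnonneg⟩ := hsub hmem
    exact ⟨rfl, hnonneg, hle⟩
  · rintro ⟨rfl, ht0, htg⟩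
    have hgraph : ((0 : EuclideanSpace ℝ (Fin d)), g 0) ∈
        {p : EuclideanSpace ℝ (Fin d) × ℝ | p.1 ∈ B ∧ p.2 = g p.1} := ⟨h0, rfl⟩
    refine ⟨segment_subset_convexHull (Set.mem_insert _ _)
      (Set.mem_insert_of_mem _ hgraph) ?_, rfl⟩
    rw [← Prod.image_mk_segment_right, segment_eq_Icc (hg0 0 h0)]
    exact ⟨t, ⟨ht0, htg⟩, rfl⟩
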